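/- Let ν be of finite variation, let h and h_n (n ∈ ℕ) be functions from S to X that are |RL| ν-integrable on S, and suppose h_n converges to h uniformly on S. Then lim_{n→∞} (|RL|)∫_S h_n dν = (|RL|)∫_S h dν. -/

import Mathlib

open Filter Topology

/-- A countable partition of `E` (indexed by `ℕ`): pairwise disjoint measurable sets whose
union is `E`.  Sets are allowed to be empty so that finite partitions are also included;
since `ν ∅ = 0`, empty pieces contribute nothing to the Riemann–Lebesgue sums. -/
def IsCtblePartition {S : Type*} [MeasurableSpace S] (E : Set S) (A : ℕ → Set S) : Prop :=
  (∀ n, MeasurableSet (A n)) ∧ Pairwise (Function.onFun Disjoint A) ∧ (⋃ n, A n) = E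

/-- `P'` is finer than `P`: every set of `P'` is included in some set of `P`. -/
def FinerThan {S : Type*} (P P' : ℕ → Set S) : Prop := ∀ n, ∃ m, P' n ⊆ P m

/-- `t` is a choice of tags for the partition `P` : `t n ∈ P n` whenever `P n ≠ ∅`. -/
def AreTags {S : Type*} (P : ℕ → Set S) (t : ℕ → S) : Prop := ∀ n, (P n).Nonempty → t n ∈ P n

/-- `h : S → X` is absolutely Riemann–Lebesgue `ν`-integrable on `E` with integral `a`:
for every `ε > 0` there is a countable partition `P₀` of `E` such that for every finer
countable partition `P = {A_n}` of `E`, `h` is bounded on every `A_n` with `ν (A_n) > 0`,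
and for every choice of tags `s_n ∈ A_n` the series `Σ_n h (s_n) • ν (A_n)` converges
absolutely with `‖Σ_n h (s_n) • ν (A_n) - a‖ < ε`. -/
def AbsRL {S : Type*} [MeasurableSpace S] {X : Type*} [NormedAddCommGroup X] [NormedSpace ℝ X]
    (ν : Set S → ℝ) (h : S → X) (E : Set S) (a : X) : Prop :=
  ∀ ε > 0, ∃ P₀ : ℕ → Set S, IsCtblePartition E P₀ ∧
    ∀ P : ℕ → Set S, IsCtblePartition E P → FinerThan P₀ P →
      (∀ n, 0 < ν (P n) → ∃ M, ∀ s ∈ P n, ‖h s‖ ≤ M) ∧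
      ∀ t : ℕ → S, AreTags P t →
        Summable (fun n => ‖ν (P n) • h (t n)‖) ∧
        ‖(∑' n, ν (P n) • h (t n)) - a‖ < ε

/-- `h : S → X` is (unconditionally) Riemann–Lebesgue `ν`-integrable on `E` with integral `a`:
as `AbsRL`, but the series is only required to converge unconditionally. -/
def RL {S : Type*} [MeasurableSpace S] {X : Type*} [NormedAddCommGroup X] [NormedSpace ℝ X]
    (ν : Set S → ℝ) (h : S → X) (E : Set S) (a : X) : Prop :=
  ∀ ε > 0, ∃ P₀ : ℕ → Set S, IsCtblePartition E P₀ ∧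
    ∀ P : ℕ → Set S, IsCtblePartition E P → FinerThan P₀ P →
      (∀ n, 0 < ν (P n) → ∃ M, ∀ s ∈ P n, ‖h s‖ ≤ M) ∧
      ∀ t : ℕ → S, AreTags P t →
        Summable (fun n => ν (P n) • h (t n)) ∧
        ‖(∑' n, ν (P n) • h (t n)) - a‖ < ε

/-- `h` is Birkhoff simple `ν`-integrable on `E` with integral `b`. -/
def BirkhoffSimple {S : Type*} [MeasurableSpace S] {X : Type*} [NormedAddCommGroup X]
    [NormedSpace ℝ X] (ν : Set S → ℝ) (h : S → X) (E : Set S) (b : X) : Prop :=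
  ∀ ε > 0, ∃ P₀ : ℕ → Set S, IsCtblePartition E P₀ ∧
    ∀ P : ℕ → Set S, IsCtblePartition E P → FinerThan P₀ P →
      ∀ t : ℕ → S, AreTags P t →
        Filter.limsup (fun n => ‖(∑ k ∈ Finset.range (n + 1), ν (P k) • h (t k)) - b‖)
          Filter.atTop < ε

/-- The set of all finite sums `Σ_i ν (A_i)` over finite pairwise disjoint families of
measurable sets contained in `E`. -/
def variationSet {S : Type*} [MeasurableSpace S] (ν : Set S → ℝ) (E : Set S) : Set ℝ :=
  { x | ∃ (k : ℕ) (A : Fin k → Set S), (∀ i, MeasurableSet (A i)) ∧ (∀ i, A i ⊆ E) ∧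
        Pairwise (Function.onFun Disjoint A) ∧ x = ∑ i, ν (A i) }

/-- The variation `ν̄ (E)` of a set function `ν`. -/
noncomputable def variation {S : Type*} [MeasurableSpace S] (ν : Set S → ℝ) (E : Set S) : ℝ :=
  sSup (variationSet ν E)

/-- `ν` is of finite variation (on `S`). -/
def FiniteVariation {S : Type*} [MeasurableSpace S] (ν : Set S → ℝ) : Prop :=
  BddAbove (variationSet ν Set.univ)

/-- The semivariation `ν̃ (A) = inf { ν̄ (B) : A ⊆ B, B measurable }`. -/
noncomputable def semivariation {S : Type*} [MeasurableSpace S] (ν : Set S → ℝ)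
    (A : Set S) : ℝ :=
  sInf { x | ∃ B : Set S, MeasurableSet B ∧ A ⊆ B ∧ x = variation ν B }

/-- A finite partition of `E`, indexed by `Fin k` (pieces may be empty). -/
def IsFinPartition {S : Type*} [MeasurableSpace S] (E : Set S) {k : ℕ}
    (A : Fin k → Set S) : Prop :=
  (∀ i, MeasurableSet (A i)) ∧ Pairwise (Function.onFun Disjoint A) ∧ (⋃ i, A i) = E

/-- `h` is Gould `ν`-integrable on `E` with integral `a`. -/
def Gould {S : Type*} [MeasurableSpace S] (ν : Set S → ℝ) (h : S → ℝ) (E : Set S)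
    (a : ℝ) : Prop :=
  ∀ ε > 0, ∃ (k : ℕ) (P₀ : Fin k → Set S), IsFinPartition E P₀ ∧
    ∀ (l : ℕ) (P : Fin l → Set S), IsFinPartition E P → (∀ j, ∃ i, P j ⊆ P₀ i) →
      ∀ t : Fin l → S, (∀ j, (P j).Nonempty → t j ∈ P j) →
        |(∑ j, ν (P j) * h (t j)) - a| < ε

/-- Condition (E) for a set function `μ` (defined at least on the measurable sets). -/
def ConditionE {S : Type*} [MeasurableSpace S] (μ : Set S → ℝ) : Prop :=
  ∀ B : ℕ → ℕ → Set S, (∀ m n, MeasurableSet (B m n)) →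
    (∀ m, Antitone fun n => B m n) →
    μ (⋃ m, ⋂ n, B m n) = 0 →
    ∃ np mp : ℕ → ℕ, StrictMono np ∧ StrictMono mp ∧
      Filter.Tendsto (fun k => μ (⋃ p, ⋃ (_ : k ≤ p), B (mp p) (np p)))
        Filter.atTop (nhds 0)

/-- The pairwise intersections of two sequences of sets, enumerated by `ℕ`. -/
def commonRefinement {S : Type*} (P Q : ℕ → Set S) (n : ℕ) : Set S :=
  P n.unpair.1 ∩ Q n.unpair.2

lemma FinerThan.commonRefinement_left {S : Type*} (P Q : ℕ → Set S) :
    FinerThan P (commonRefinement P Q) :=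
  fun n => ⟨n.unpair.1, Set.inter_subset_left⟩

lemma FinerThan.commonRefinement_right {S : Type*} (P Q : ℕ → Set S) :
    FinerThan Q (commonRefinement P Q) :=
  fun n => ⟨n.unpair.2, Set.inter_subset_right⟩

lemma IsCtblePartition.commonRefinement {S : Type*} [MeasurableSpace S] {E : Set S}
    {P Q : ℕ → Set S} (hP : IsCtblePartition E P) (hQ : IsCtblePartition E Q) :
    IsCtblePartition E (commonRefinement P Q) := by
  refine ⟨fun n => (hP.1 _).inter (hQ.1 _), fun m n hmn => ?_, ?_⟩
  · by_cases h1 : m.unpair.1 = n.unpair.1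
    · have h2 : m.unpair.2 ≠ n.unpair.2 := fun h2 =>
        hmn (by rw [← Nat.pair_unpair m, ← Nat.pair_unpair n, h1, h2])
      exact (hQ.2.1 h2).mono Set.inter_subset_right Set.inter_subset_right
    · exact (hP.2.1 h1).mono Set.inter_subset_left Set.inter_subset_left
  · ext x
    constructor
    · intro hx
      obtain ⟨n, hn⟩ := Set.mem_iUnion.1 hx
      rw [← hP.2.2]
      exact Set.mem_iUnion.2 ⟨_, hn.1⟩
    · intro hx
      obtain ⟨i, hi⟩ := Set.mem_iUnion.1 (hP.2.2.symm ▸ hx)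
      obtain ⟨j, hj⟩ := Set.mem_iUnion.1 (hQ.2.2.symm ▸ hx)
      refine Set.mem_iUnion.2 ⟨Nat.pair i j, ?_⟩
      simp only [_root_.commonRefinement, Nat.unpair_pair]
      exact ⟨hi, hj⟩

lemma exists_areTags {S : Type*} [Nonempty S] (P : ℕ → Set S) : ∃ t : ℕ → S, AreTags P t := by
  have H (n : ℕ) : ∃ s : S, (P n).Nonempty → s ∈ P n := by
    by_cases hP : (P n).Nonempty
    · exact ⟨hP.some, fun _ => hP.some_mem⟩
    · exact ⟨Classical.arbitrary S, fun h => absurd h hP⟩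
  choose t ht using H
  exact ⟨t, ht⟩

lemma IsCtblePartition.sum_range_mem_variationSet {S : Type*} [MeasurableSpace S] {E : Set S}
    {P : ℕ → Set S} (hP : IsCtblePartition E P) (ν : Set S → ℝ) (k : ℕ) :
    ∑ i ∈ Finset.range k, ν (P i) ∈ variationSet ν E :=
  ⟨k, fun i => P i, fun i => hP.1 i,
    fun i => (Set.subset_iUnion P i).trans hP.2.2.subset,
    fun _ _ hij => hP.2.1 (Fin.val_injective.ne hij),
    (Fin.sum_univ_eq_sum_range (fun i => ν (P i)) k).symm⟩

/-- Integrals of uniformly `δ`-close functions differ by at most `δ` times a bound of the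
variation. -/
lemma AbsRL.norm_sub_le {S : Type*} [Nonempty S] [MeasurableSpace S] {X : Type*}
    [NormedAddCommGroup X] [NormedSpace ℝ X] [CompleteSpace X] {ν : Set S → ℝ} {E : Set S}
    (hνnn : ∀ A : Set S, MeasurableSet A → 0 ≤ ν A) {M : ℝ}
    (hM : M ∈ upperBounds (variationSet ν E))
    {f g : S → X} {a b : X} (hf : AbsRL ν f E a) (hg : AbsRL ν g E b) {δ : ℝ}
    (hfg : ∀ s, ‖f s - g s‖ ≤ δ) : ‖a - b‖ ≤ M * δ := by
  refine le_of_forall_pos_le_add fun ε hε => ?_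
  obtain ⟨P, hP, hPf⟩ := hf (ε / 2) (half_pos hε)
  obtain ⟨Q, hQ, hQg⟩ := hg (ε / 2) (half_pos hε)
  set R := commonRefinement P Q
  have hR : IsCtblePartition E R := hP.commonRefinement hQ
  obtain ⟨t, ht⟩ := exists_areTags R
  obtain ⟨hfs, hfa⟩ := (hPf R hR (.commonRefinement_left P Q)).2 t ht
  obtain ⟨hgs, hgb⟩ := (hQg R hR (.commonRefinement_right P Q)).2 t ht
  have hle (k : ℕ) : ∑ i ∈ Finset.range k, ν (R i) ≤ M :=
    hM (hR.sum_range_mem_variationSet ν k)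
  have hν : Summable fun n => ν (R n) :=
    summable_of_sum_range_le (fun n => hνnn _ (hR.1 n)) hle
  have hδ : 0 ≤ δ := (norm_nonneg _).trans (hfg (Classical.arbitrary S))
  have hsum : ‖(∑' n, ν (R n) • f (t n)) - ∑' n, ν (R n) • g (t n)‖ ≤ M * δ := by
    rw [← hfs.of_norm.tsum_sub hgs.of_norm]
    refine (tsum_of_norm_bounded (hν.mul_right δ).hasSum fun n => ?_).trans ?_
    · rw [← smul_sub, norm_smul, Real.norm_of_nonneg (hνnn _ (hR.1 n))]
      exact mul_le_mul_of_nonneg_left (hfg _) (hνnn _ (hR.1 n))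
    · rw [tsum_mul_right]
      exact mul_le_mul_of_nonneg_right
        (Real.tsum_le_of_sum_range_le (fun n => hνnn _ (hR.1 n)) hle) hδ
  set F := ∑' n, ν (R n) • f (t n)
  set G := ∑' n, ν (R n) • g (t n)
  calc ‖a - b‖ = ‖(F - G) - (F - a) + (G - b)‖ := by congr 1; abel
    _ ≤ ‖F - G‖ + ‖F - a‖ + ‖G - b‖ :=
      (norm_add_le _ _).trans (add_le_add_left (_root_.norm_sub_le _ _) _)
    _ ≤ M * δ + ε := by linarith

/-- convergence of the `|RL|` integrals under uniform convergence of the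
integrands, for `ν` of finite variation. -/
theorem absRL_tendsto_of_tendstoUniformly
    {S : Type*} [Nonempty S] [MeasurableSpace S]
    {X : Type*} [NormedAddCommGroup X] [NormedSpace ℝ X] [CompleteSpace X]
    (ν : Set S → ℝ) (hν0 : ν ∅ = 0) (hνnn : ∀ A : Set S, MeasurableSet A → 0 ≤ ν A)
    (hfv : FiniteVariation ν)
    (h : S → X) (hn : ℕ → S → X) (a : X) (an : ℕ → X)
    (hh : AbsRL ν h Set.univ a) (hhn : ∀ n : ℕ, AbsRL ν (hn n) Set.univ (an n))
    (hunif : TendstoUniformly hn h Filter.atTop) :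
    Filter.Tendsto an Filter.atTop (nhds a) := by
  obtain ⟨M, hM⟩ := hfv
  rw [Metric.tendsto_atTop]
  intro ε hε
  have hδ : 0 < ε / (|M| + 1) := by positivity
  obtain ⟨N, hN⟩ := eventually_atTop.1 (Metric.tendstoUniformly_iff.1 hunif _ hδ)
  refine ⟨N, fun n hNn => ?_⟩
  have hle := (hhn n).norm_sub_le hνnn hM hh (δ := ε / (|M| + 1)) fun s => by
    rw [← dist_eq_norm, dist_comm]
    exact (hN n hNn s).le
  rw [dist_eq_norm]
  refine hle.trans_lt ?_
  rw [mul_div_assoc', div_lt_iff₀ (by positivity)]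
  nlinarith [le_abs_self M]
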